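/- Let Z be a standard p-dimensional normal vector, h : ℝ^p → ℝ a bounded function with bounded mixed partial derivatives up to order 3, Φh = E[h(Z)], (T_u h)(w) = E[h(w e^{−u} + √(1−e^{−2u}) Z)] for u ≥ 0, and g(w) = −∫₀^∞ [(T_u h)(w) − Φh] du. Then for every k ∈ {1,2,3} and all indices i₁,…,i_k ∈ {1,…,p}, the k-th order mixed partial derivative of g satisfies |∂^k g(w)/(∂w_{i₁}···∂w_{i_k})| ≤ (1/k)·sup_{w'} |∂^k h(w')/(∂w_{i₁}···∂w_{i_k})| for all w ∈ ℝ^p; moreover D^k g(w) = −∫₀^∞ e^{−ku} E[D^k h(w e^{−u} + √(1−e^{−2u}) Z)] du. -/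

import Mathlib

open MeasureTheory ProbabilityTheory Real

/-- The standard `p`-dimensional Gaussian measure. -/
noncomputable def stdGaussianPi (p : ℕ) : Measure (Fin p → ℝ) :=
  Measure.pi fun _ => gaussianReal 0 1

/-- The Ornstein–Uhlenbeck semigroup
`(T_u h)(w) = E[h(w e^{-u} + √(1 - e^{-2u}) Z)]`. -/
noncomputable def ouSemigroup {p : ℕ} (u : ℝ) (h : (Fin p → ℝ) → ℝ)
    (w : Fin p → ℝ) : ℝ :=
  ∫ z, h (fun i => w i * Real.exp (-u) + Real.sqrt (1 - Real.exp (-2 * u)) * z i)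
    ∂(stdGaussianPi p)

/-- The `k`-th order mixed partial derivative of `g : ℝᵖ → ℝ`. -/
noncomputable def mixedPartial {p : ℕ} (k : ℕ) (g : (Fin p → ℝ) → ℝ)
    (idx : Fin k → Fin p) (w : Fin p → ℝ) : ℝ :=
  iteratedFDeriv ℝ k g w fun l => Pi.single (idx l) 1

instance (p : ℕ) : IsProbabilityMeasure (stdGaussianPi p) := by
  unfold stdGaussianPi; infer_instance

/-- The point `w e^{-u} + √(1 - e^{-2u}) z`, as a function of `w` and of the pair `(u, z)`. -/
noncomputable def ouPoint {p : ℕ} (w : Fin p → ℝ) (q : ℝ × (Fin p → ℝ)) : Fin p → ℝ :=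
  fun i => w i * Real.exp (-q.1) + Real.sqrt (1 - Real.exp (-2 * q.1)) * q.2 i

/-- The product of Lebesgue measure on `(0, ∞)` and the standard Gaussian measure. -/
noncomputable def ouMeasure (p : ℕ) : Measure (ℝ × (Fin p → ℝ)) :=
  (volume.restrict (Set.Ioi (0 : ℝ))).prod (stdGaussianPi p)

lemma continuous_ouPoint {p : ℕ} (w : Fin p → ℝ) : Continuous (ouPoint w) := by
  unfold ouPoint
  fun_prop

lemma hasFDerivAt_ouPoint {p : ℕ} (w : Fin p → ℝ) (q : ℝ × (Fin p → ℝ)) :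
    HasFDerivAt (fun w => ouPoint w q)
      (Real.exp (-q.1) • ContinuousLinearMap.id ℝ (Fin p → ℝ)) w := by
  have h : (fun w => ouPoint w q) = fun w : Fin p → ℝ =>
      Real.exp (-q.1) • w + Real.sqrt (1 - Real.exp (-2 * q.1)) • q.2 := by
    ext w i
    simp [ouPoint, mul_comm]
  rw [h]
  exact ((hasFDerivAt_id (𝕜 := ℝ) w).const_smul (Real.exp (-q.1))).add_const _

lemma integrableOn_exp_neg_mul {c : ℝ} (hc : 0 < c) :
    Integrable (fun u : ℝ => Real.exp (-c * u)) (volume.restrict (Set.Ioi (0 : ℝ))) :=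
  integrableOn_exp_mul_Ioi (neg_lt_zero.mpr hc) 0

lemma integrable_exp_ouMeasure {p : ℕ} {c : ℝ} (hc : 0 < c) (C : ℝ) :
    Integrable (fun q => Real.exp (-c * q.1) * C) (ouMeasure p) :=
  (integrableOn_exp_neg_mul hc).mul_prod (integrable_const C)

lemma integral_exp_ouMeasure {p : ℕ} {c : ℝ} (hc : 0 < c) (C : ℝ) :
    ∫ q, Real.exp (-c * q.1) * C ∂(ouMeasure p) = 1 / c * C := by
  have h := integral_exp_mul_Ioi (neg_lt_zero.mpr hc) 0
  unfold ouMeasure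
  rw [integral_prod _ (integrable_exp_ouMeasure hc C)]
  simp only [integral_const, probReal_univ, one_smul]
  rw [integral_mul_const, h]
  simp

lemma integrable_norm_stdGaussianPi (p : ℕ) :
    Integrable (fun z : Fin p → ℝ => ‖z‖) (stdGaussianPi p) := by
  have h : ∀ i : Fin p, Integrable (fun z : Fin p → ℝ => ‖z i‖) (stdGaussianPi p) := fun i =>
    (integrable_eval (μ := fun _ : Fin p => gaussianReal 0 1) (i := i)
      ((memLp_id_gaussianReal 1).integrable (by simp))).norm
  refine (integrable_finsetSum Finset.univ fun i _ => h i).mono'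
    continuous_norm.aestronglyMeasurable (Filter.Eventually.of_forall fun z => ?_)
  rw [norm_norm, pi_norm_le_iff_of_nonneg (Finset.sum_nonneg fun i _ => norm_nonneg _)]
  exact fun i => Finset.single_le_sum (f := fun i => ‖z i‖) (fun j _ => norm_nonneg _)
    (Finset.mem_univ i)

/-- Along the Ornstein–Uhlenbeck flow, the starting point is forgotten exponentially fast. -/
lemma norm_ouPoint_sub_le {p : ℕ} (w : Fin p → ℝ) {q : ℝ × (Fin p → ℝ)} (hq : 0 < q.1) :
    ‖ouPoint w q - q.2‖ ≤ Real.exp (-1 * q.1) * (‖w‖ + ‖q.2‖) := by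
  obtain ⟨u, z⟩ := q
  dsimp only at hq ⊢
  have he1 : Real.exp (-2 * u) ≤ 1 := Real.exp_le_one_iff.mpr (by linarith)
  have he2 : Real.exp (-2 * u) ≤ Real.exp (-1 * u) := Real.exp_le_exp.mpr (by linarith)
  have hs0 : 0 ≤ Real.sqrt (1 - Real.exp (-2 * u)) := Real.sqrt_nonneg _
  have hsq := Real.mul_self_sqrt (sub_nonneg.mpr he1)
  have hs1 : Real.sqrt (1 - Real.exp (-2 * u)) ≤ 1 :=
    Real.sqrt_le_one.mpr (by linarith [Real.exp_pos (-2 * u)])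
  have habs : |Real.sqrt (1 - Real.exp (-2 * u)) - 1| ≤ Real.exp (-1 * u) := by
    rw [abs_of_nonpos (by linarith)]
    nlinarith
  have h : ouPoint w (u, z) - z = Real.exp (-1 * u) • w +
      (Real.sqrt (1 - Real.exp (-2 * u)) - 1) • z := by
    ext i
    simp [ouPoint]
    ring
  rw [h, mul_add]
  refine (norm_add_le _ _).trans (add_le_add ?_ ?_)
  · rw [norm_smul, Real.norm_eq_abs, Real.abs_exp]
  · rw [norm_smul, Real.norm_eq_abs]
    gcongr

lemma integrable_exp_smul_comp_ouPoint {p : ℕ} {V : Type*} [NormedAddCommGroup V]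
    [NormedSpace ℝ V] {F : (Fin p → ℝ) → V} (hF : Continuous F) {C : ℝ} (hC : ∀ x, ‖F x‖ ≤ C)
    {c : ℝ} (hc : 0 < c) (w : Fin p → ℝ) :
    Integrable (fun q => Real.exp (-c * q.1) • F (ouPoint w q)) (ouMeasure p) := by
  have hA := continuous_ouPoint w
  refine (integrable_exp_ouMeasure hc C).mono'
    (Continuous.aestronglyMeasurable (by fun_prop)) (Filter.Eventually.of_forall fun q => ?_)
  rw [norm_smul, Real.norm_eq_abs, Real.abs_exp]
  gcongr
  exact hC _

/-- Differentiation under the integral sign along the Ornstein–Uhlenbeck flow. -/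
lemma hasFDerivAt_integral_ouPoint {p : ℕ} {V : Type*} [NormedAddCommGroup V]
    [NormedSpace ℝ V] {F : (Fin p → ℝ) → V} (hF : ContDiff ℝ 1 F)
    {C : ℝ} (hC : ∀ x, ‖fderiv ℝ F x‖ ≤ C) {c : ℝ} (hc : 0 ≤ c)
    {b : ℝ × (Fin p → ℝ) → V} (hb : Continuous b) (w : Fin p → ℝ)
    (hInt : Integrable (fun q => Real.exp (-c * q.1) • F (ouPoint w q) - b q) (ouMeasure p)) :
    HasFDerivAt (fun w => ∫ q, (Real.exp (-c * q.1) • F (ouPoint w q) - b q) ∂(ouMeasure p))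
      (∫ q, Real.exp (-(c + 1) * q.1) • fderiv ℝ F (ouPoint w q) ∂(ouMeasure p)) w := by
  have hFc := hF.continuous
  have hF'c := hF.continuous_fderiv one_ne_zero
  refine hasFDerivAt_integral_of_dominated_of_fderiv_le (s := Set.univ) Filter.univ_mem
    (F' := fun w q => Real.exp (-(c + 1) * q.1) • fderiv ℝ F (ouPoint w q))
    (bound := fun q => Real.exp (-(c + 1) * q.1) * C)
    (Filter.Eventually.of_forall fun w => ?_) hInt ?_ ?_
    (integrable_exp_ouMeasure (by linarith) C) ?_
  · have hA := continuous_ouPoint w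
    exact Continuous.aestronglyMeasurable (by fun_prop)
  · have hA := continuous_ouPoint w
    exact Continuous.aestronglyMeasurable (by fun_prop)
  · refine Filter.Eventually.of_forall fun q w _ => ?_
    rw [norm_smul, Real.norm_eq_abs, Real.abs_exp]
    gcongr
    exact hC _
  · refine Filter.Eventually.of_forall fun q w _ => ?_
    have h := (((hF.differentiable one_ne_zero (ouPoint w q)).hasFDerivAt.comp w
      (hasFDerivAt_ouPoint w q)).const_smul (Real.exp (-c * q.1))).sub_const (b q)
    refine h.congr_fderiv ?_
    rw [ContinuousLinearMap.comp_smul, ContinuousLinearMap.comp_id, smul_smul, ← Real.exp_add]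
    ring_nf

/-- A multilinear form on `ℝᵖ` is bounded by its values on the standard basis. -/
lemma norm_le_of_forall_single {p k : ℕ}
    (f : ContinuousMultilinearMap ℝ (fun _ : Fin k => (Fin p → ℝ)) ℝ) {C : ℝ}
    (hC : ∀ idx : Fin k → Fin p, |f fun l => Pi.single (idx l) 1| ≤ C) :
    ‖f‖ ≤ ∑ _idx : Fin k → Fin p, C := by
  have hsum : 0 ≤ ∑ _idx : Fin k → Fin p, C :=
    Finset.sum_nonneg fun idx _ => (abs_nonneg _).trans (hC idx)
  refine f.opNorm_le_bound hsum fun m => ?_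
  have hm : m = fun l => ∑ i, m l i • (Pi.single i 1 : Fin p → ℝ) := by
    ext l j
    simp [Finset.sum_apply, Pi.single_apply]
  have hf : f m = ∑ idx : Fin k → Fin p, (∏ l, m l (idx l)) * f fun l => Pi.single (idx l) 1 := by
    conv_lhs => rw [hm]
    rw [f.map_sum]
    refine Finset.sum_congr rfl fun idx _ => ?_
    rw [f.map_smul_univ, smul_eq_mul]
  rw [hf, Finset.sum_mul]
  refine (norm_sum_le _ _).trans (Finset.sum_le_sum fun idx _ => ?_)
  rw [norm_mul, mul_comm, norm_prod]
  have hprod : ∏ l, ‖m l (idx l)‖ ≤ ∏ l, ‖m l‖ :=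
    Finset.prod_le_prod (fun _ _ => norm_nonneg _) fun l _ => norm_le_pi_norm _ _
  exact mul_le_mul (hC idx) hprod (Finset.prod_nonneg fun _ _ => norm_nonneg _)
    ((abs_nonneg _).trans (hC idx))

/-- For Lipschitz `h`, the difference `h(w e^{-u} + √(1 - e^{-2u}) z) - h(z)` is
integrable in `(u, z)`. -/
lemma integrable_comp_ouPoint_sub {p : ℕ} {h : (Fin p → ℝ) → ℝ} (hh : Differentiable ℝ h)
    {L : ℝ} (hL : ∀ x, ‖fderiv ℝ h x‖ ≤ L) (w : Fin p → ℝ) :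
    Integrable (fun q => h (ouPoint w q) - h q.2) (ouMeasure p) := by
  have hA := continuous_ouPoint w
  have hc := hh.continuous
  have hbound : Integrable (fun q : ℝ × (Fin p → ℝ) =>
      Real.exp (-1 * q.1) * (L * (‖w‖ + ‖q.2‖))) (ouMeasure p) :=
    (integrableOn_exp_neg_mul one_pos).mul_prod
      (((integrable_const ‖w‖).add (integrable_norm_stdGaussianPi p)).const_mul L)
  refine hbound.mono' (Continuous.aestronglyMeasurable (by fun_prop)) ?_
  have hpos : ∀ᵐ q ∂(ouMeasure p), 0 < q.1 :=
    Measure.quasiMeasurePreserving_fst.ae (ae_restrict_mem measurableSet_Ioi)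
  filter_upwards [hpos] with q hq
  have hlip := convex_univ.norm_image_sub_le_of_norm_fderiv_le (fun x _ => hh x)
    (fun x _ => hL x) (Set.mem_univ q.2) (Set.mem_univ (ouPoint w q))
  have hL0 : 0 ≤ L := (norm_nonneg _).trans (hL 0)
  calc ‖h (ouPoint w q) - h q.2‖ ≤ L * ‖ouPoint w q - q.2‖ := hlip
    _ ≤ L * (Real.exp (-1 * q.1) * (‖w‖ + ‖q.2‖)) := by
      gcongr
      exact norm_ouPoint_sub_le w hq
    _ = _ := by ring

lemma integral_ouSemigroup_sub {p : ℕ} {h : (Fin p → ℝ) → ℝ} (hh : Differentiable ℝ h)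
    {M : ℝ} (hM : ∀ x, |h x| ≤ M) {L : ℝ} (hL : ∀ x, ‖fderiv ℝ h x‖ ≤ L) (w : Fin p → ℝ) :
    ∫ u in Set.Ioi (0 : ℝ), (ouSemigroup u h w - ∫ z, h z ∂(stdGaussianPi p)) =
      ∫ q, (h (ouPoint w q) - h q.2) ∂(ouMeasure p) := by
  have hc := hh.continuous
  have hA := continuous_ouPoint w
  have hi := integrable_comp_ouPoint_sub hh hL w
  unfold ouMeasure at hi ⊢
  rw [integral_prod _ hi]
  congr 1
  ext u
  rw [integral_sub]
  · rfl
  · exact .of_bound (Continuous.aestronglyMeasurable (by fun_prop)) M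
      (Filter.Eventually.of_forall fun z => hM _)
  · exact .of_bound hc.aestronglyMeasurable M (Filter.Eventually.of_forall fun z => hM _)

/-- The inductive step: the order of differentiation increases by one. -/
lemma iteratedFDeriv_succ_integral_ouPoint {p n : ℕ} {h g : (Fin p → ℝ) → ℝ}
    (hh : ContDiff ℝ (n + 1) h) {C : ℝ} (hC : ∀ x, ‖iteratedFDeriv ℝ (n + 1) h x‖ ≤ C)
    {b : ℝ × (Fin p → ℝ) → ContinuousMultilinearMap ℝ (fun _ : Fin n => (Fin p → ℝ)) ℝ}
    (hb : Continuous b)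
    (hInt : ∀ w, Integrable (fun q =>
      Real.exp (-(n : ℝ) * q.1) • iteratedFDeriv ℝ n h (ouPoint w q) - b q) (ouMeasure p))
    (hg : ∀ w, iteratedFDeriv ℝ n g w = -∫ q, (Real.exp (-(n : ℝ) * q.1) •
      iteratedFDeriv ℝ n h (ouPoint w q) - b q) ∂(ouMeasure p)) (w : Fin p → ℝ) :
    iteratedFDeriv ℝ (n + 1) g w = -∫ q, Real.exp (-((n + 1 : ℕ) : ℝ) * q.1) •
      iteratedFDeriv ℝ (n + 1) h (ouPoint w q) ∂(ouMeasure p) := by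
  have hF : ContDiff ℝ 1 (iteratedFDeriv ℝ n h) :=
    hh.iteratedFDeriv_right (by rw [add_comm])
  have hC' : ∀ x, ‖fderiv ℝ (iteratedFDeriv ℝ n h) x‖ ≤ C := fun x => by
    rw [norm_fderiv_iteratedFDeriv]
    exact hC x
  have hd := (hasFDerivAt_integral_ouPoint hF hC' n.cast_nonneg hb w (hInt w)).neg
  have hgd := hd.fderiv
  rw [show -_ = iteratedFDeriv ℝ n g from (funext hg).symm] at hgd
  have hi' := integrable_exp_smul_comp_ouPoint (hF.continuous_fderiv one_ne_zero) hC'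
    n.cast_add_one_pos w
  have hi := integrable_exp_smul_comp_ouPoint (hh.continuous_iteratedFDeriv' (m := n + 1)) hC
    (c := ((n + 1 : ℕ) : ℝ)) (by positivity) w
  ext m
  rw [iteratedFDeriv_succ_apply_left, hgd, neg_apply, neg_apply, neg_apply,
    ContinuousLinearMap.integral_apply hi', ContinuousMultilinearMap.integral_apply
      (hi'.apply_continuousLinearMap _), ContinuousMultilinearMap.integral_apply hi]
  push_cast
  rfl

/-- **Derivative bounds for the Stein equation solution** (Goldstein–Rinott, Lemma 3.1,
second part). For `g(w) = -∫₀^∞ [(T_u h)(w) - Φh] du`, every mixed partial derivative of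
`g` of order `k ∈ {1,2,3}` is bounded by `1/k` times the supremum of the corresponding
mixed partial derivative of `h`; moreover
`D^k g(w) = -∫₀^∞ e^{-ku} E[D^k h(w e^{-u} + √(1-e^{-2u}) Z)] du`. -/
theorem stein_equation_derivative_bounds
    {p : ℕ} (h : (Fin p → ℝ) → ℝ)
    (hhbdd : ∃ C, ∀ x, |h x| ≤ C) (hh : ContDiff ℝ 3 h)
    (hDbdd : ∀ k : ℕ, 1 ≤ k → k ≤ 3 → ∃ C, ∀ (idx : Fin k → Fin p) (w : Fin p → ℝ),
      |mixedPartial k h idx w| ≤ C)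
    (Φh : ℝ) (hΦh : Φh = ∫ z, h z ∂(stdGaussianPi p))
    (g : (Fin p → ℝ) → ℝ)
    (hg : g = fun w => -∫ u in Set.Ioi (0 : ℝ), (ouSemigroup u h w - Φh)) :
    ∀ k : ℕ, 1 ≤ k → k ≤ 3 → ∀ (idx : Fin k → Fin p) (w : Fin p → ℝ),
      (|mixedPartial k g idx w| ≤ (1 / (k : ℝ)) * ⨆ w' : Fin p → ℝ,
        |mixedPartial k h idx w'|) ∧
      mixedPartial k g idx w =
        -∫ u in Set.Ioi (0 : ℝ), Real.exp (-(k : ℝ) * u) *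
          ∫ z, mixedPartial k h idx
            (fun i => w i * Real.exp (-u) + Real.sqrt (1 - Real.exp (-2 * u)) * z i)
            ∂(stdGaussianPi p) := by
  obtain ⟨M, hM⟩ := hhbdd
  have hbdd : ∀ k : ℕ, 1 ≤ k → k ≤ 3 → ∃ C, ∀ x, ‖iteratedFDeriv ℝ k h x‖ ≤ C := by
    intro k h1 h3
    obtain ⟨C, hC⟩ := hDbdd k h1 h3
    exact ⟨_, fun x => norm_le_of_forall_single _ fun idx => hC idx x⟩
  have hsmooth : ∀ k : ℕ, k ≤ 3 → ContDiff ℝ k h := fun k hk => hh.of_le (by exact_mod_cast hk)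
  have hcont : ∀ k : ℕ, k ≤ 3 → Continuous (iteratedFDeriv ℝ k h) := fun k hk =>
    hh.continuous_iteratedFDeriv (by exact_mod_cast hk)
  have hInt : ∀ k : ℕ, 1 ≤ k → k ≤ 3 → ∀ w, Integrable (fun q =>
      Real.exp (-(k : ℝ) * q.1) • iteratedFDeriv ℝ k h (ouPoint w q)) (ouMeasure p) := by
    intro k h1 h3 w
    obtain ⟨C, hC⟩ := hbdd k h1 h3
    exact integrable_exp_smul_comp_ouPoint (hcont k h3) hC (by exact_mod_cast h1) w
  have hrep : ∀ k : ℕ, 1 ≤ k → k ≤ 3 → ∀ w, iteratedFDeriv ℝ k g w =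
      -∫ q, Real.exp (-(k : ℝ) * q.1) • iteratedFDeriv ℝ k h (ouPoint w q) ∂(ouMeasure p) := by
    intro k h1
    induction k, h1 using Nat.le_induction with
    | base =>
      intro _ w
      obtain ⟨C, hC⟩ := hbdd 1 le_rfl (by norm_num)
      have hL : ∀ x, ‖fderiv ℝ h x‖ ≤ C := fun x => by
        rw [← norm_iteratedFDeriv_one]
        exact hC x
      have hdiff : Differentiable ℝ h := hh.differentiable (by norm_num)
      let e := (continuousMultilinearCurryFin0 ℝ (Fin p → ℝ) ℝ).symm.toContinuousLinearEquiv
      have he : ∀ (f : (Fin p → ℝ) → ℝ) x, iteratedFDeriv ℝ 0 f x = e (f x) := fun f x => by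
        rw [iteratedFDeriv_zero_eq_comp]
        rfl
      refine iteratedFDeriv_succ_integral_ouPoint (n := 0) (hsmooth 1 (by norm_num)) hC
        (b := fun q => e (h q.2)) ?_ (fun w => ?_) (fun w => ?_) w
      · exact e.continuous.comp (hdiff.continuous.comp continuous_snd)
      · simp only [CharP.cast_eq_zero, neg_zero, zero_mul, Real.exp_zero, one_smul, he,
          ← map_sub]
        exact e.toContinuousLinearMap.integrable_comp (integrable_comp_ouPoint_sub hdiff hL w)
      · simp only [CharP.cast_eq_zero, neg_zero, zero_mul, Real.exp_zero, one_smul, he,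
          ← map_sub]
        rw [e.integral_comp_comm, ← map_neg, congrFun hg w, hΦh, integral_ouSemigroup_sub hdiff hM hL]
    | succ n h1 ih =>
      intro h3 w
      obtain ⟨C, hC⟩ := hbdd (n + 1) (by omega) h3
      exact iteratedFDeriv_succ_integral_ouPoint (hsmooth (n + 1) h3) hC (b := 0)
        continuous_const (fun w => by simpa using hInt n h1 (by omega) w)
        (fun w => by simpa using ih (by omega) w) w
  intro k h1 h3 idx w
  have hk : (0 : ℝ) < k := by exact_mod_cast h1
  have happly : mixedPartial k g idx w = -∫ q, Real.exp (-(k : ℝ) * q.1) *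
      mixedPartial k h idx (ouPoint w q) ∂(ouMeasure p) := by
    rw [mixedPartial, hrep k h1 h3 w, neg_apply,
      ContinuousMultilinearMap.integral_apply (hInt k h1 h3 w)]
    rfl
  refine ⟨?_, ?_⟩
  · obtain ⟨C, hC⟩ := hDbdd k h1 h3
    have hsup : ∀ x, |mixedPartial k h idx x| ≤ ⨆ w', |mixedPartial k h idx w'| :=
      le_ciSup (f := fun w' => |mixedPartial k h idx w'|)
        ⟨C, Set.forall_mem_range.mpr (hC idx)⟩
    rw [happly, abs_neg, ← Real.norm_eq_abs, ← integral_exp_ouMeasure (p := p) hk]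
    refine norm_integral_le_of_norm_le (integrable_exp_ouMeasure hk _)
      (Filter.Eventually.of_forall fun q => ?_)
    rw [norm_mul, Real.norm_eq_abs, Real.abs_exp]
    gcongr
    exact hsup _
  · have hi : Integrable (fun q => Real.exp (-(k : ℝ) * q.1) *
        mixedPartial k h idx (ouPoint w q)) (ouMeasure p) :=
      (ContinuousMultilinearMap.apply ℝ (fun _ : Fin k => (Fin p → ℝ)) ℝ
        fun l => Pi.single (idx l) 1).integrable_comp (hInt k h1 h3 w)
    unfold ouMeasure at hi happly
    rw [happly, integral_prod _ hi]
    simp only [integral_const_mul]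
    rfl
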